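/- (Proposition 3 of the paper: forward resource-constrained shortest-path completion bound.) Fix a partial route suffix σ = (s_1,…,s_l) of customers (first customer n = s_1, ending at the depot) and a real remaining load rl ≥ 0. Define ap(σ) = Σ_{j=1}^{l−1} d(s_j,s_{j+1}) + d(s_l,0) and Γ(σ) = Σ_{j=1}^{l−1} γ(s_j,s_{j+1}) + γ(s_l,0). Define ψ(n, rl + μ_n) as the infimum, over all finite (possibly empty, possibly repeating) sequences (w_1,…,w_m) of customers with μ_{w_1} + … + μ_{w_m} + μ_n ≤ rl + μ_n, of the path value (d(0,w_1)+γ(0,w_1)) + Σ_{j=1}^{m−1}(d(w_j,w_{j+1})+γ(w_j,w_{j+1})) + (d(w_m,n)+γ(w_m,n)) (equal to d(0,n)+γ(0,n) for the empty sequence). Then for every finite sequence e = (u_1,…,u_h) of customers with μ_{u_1} + … + μ_{u_h} ≤ rl, the reduced cost of the route r = (v_0, u_1,…,u_h, s_1,…,s_l, v_0), namely φ(r) = c_r plus the sum of γ over all consecutive arcs of r, satisfies φ(r) ≥ ψ(n, rl + μ_n) + ap(σ) + Γ(σ). -/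

import Mathlib

/-- `Ψ(k,q) = max(⌈(k−q)/Q⌉, 0)`: number of replenishment trips of capacity `Q`
needed to fulfill a demand of `k` with remaining quantity `q`. -/
noncomputable def psi (Q k q : ℕ) : ℤ :=
  max ⌈((k : ℚ) - (q : ℚ)) / (Q : ℚ)⌉ 0

/-- The value functions `ν^r(i,q)` of a route `r = (v_0, v_{t_1},…,v_{t_h}, v_0)`
(with `t 0 = 0`), computed by backward recursion on the fuel `h − i`:
`nuF Q d p t (h - i) i q = ν^r(i,q)`. -/
noncomputable def nuF (Q : ℕ) (d p : ℕ → ℕ → ℝ) (s : ℕ → ℕ) :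
    ℕ → ℕ → ℕ → ℝ
  | 0, i, _ => d (s i) 0
  | j + 1, i, q =>
      min
        (d (s i) (s (i + 1)) + ∑' k : ℕ,
          ((d (s (i + 1)) 0 + d 0 (s (i + 1))) * (psi Q k q : ℝ)
            + nuF Q d p s j (i + 1)
                ((Q : ℤ) * psi Q k q + (q : ℤ) - (k : ℤ)).toNat) * p (s (i + 1)) k)
        (d (s i) 0 + d 0 (s (i + 1)) + ∑' k : ℕ,
          ((d (s (i + 1)) 0 + d 0 (s (i + 1))) * (psi Q k Q : ℝ)
            + nuF Q d p s j (i + 1)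
                ((Q : ℤ) * psi Q k Q + (Q : ℤ) - (k : ℤ)).toNat) * p (s (i + 1)) k)

/-- The node sequence of the route visiting the customers of the list `t` in
order (node `0` is the depot, node `j ≥ 1` is the `j`-th customer of `t`). -/
def routeSeq (t : List ℕ) : ℕ → ℕ := fun j => if j = 0 then 0 else t.getD (j - 1) 0

/-- Expected cost `c_r = ν^r(0,Q)` of the route visiting the customers of `t`
in order, under optimal restocking. -/
noncomputable def routeCost (Q : ℕ) (d p : ℕ → ℕ → ℝ) (t : List ℕ) : ℝ :=
  nuF Q d p (routeSeq t) t.length 0 Q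

/-- `chainVal c a [w₁,…,w_m] b = c(a,w₁) + c(w₁,w₂) + … + c(w_m,b)`
(equal to `c(a,b)` for the empty list): total arc value of the path
`a → w₁ → … → w_m → b`. -/
def chainVal (c : ℕ → ℕ → ℝ) : ℕ → List ℕ → ℕ → ℝ
  | a, [], b => c a b
  | a, w :: ws, b => c a w + chainVal c w ws b

/-- Reduced cost `φ(r) = c_r + Σ γ` over all consecutive arcs of the route
visiting the customers of `t` in order. -/
noncomputable def routePhi (Q : ℕ) (d p γ : ℕ → ℕ → ℝ) (t : List ℕ) : ℝ :=
  routeCost Q d p t + chainVal γ 0 t 0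

/-- Expected demand `μ_i = Σ_k k·p_i(k)` of customer `i`. -/
noncomputable def muE (p : ℕ → ℕ → ℝ) (i : ℕ) : ℝ := ∑' k : ℕ, (k : ℝ) * p i k

theorem psi_nonneg (Q k q : ℕ) : 0 ≤ psi Q k q := le_max_right _ _

theorem psi_le {Q : ℕ} (hQ : 1 ≤ Q) (k q : ℕ) : psi Q k q ≤ k := by
  refine max_le (Int.ceil_le.2 ?_) (Int.natCast_nonneg k)
  have hQ' : (1 : ℚ) ≤ Q := by exact_mod_cast hQ
  have hk : (0 : ℚ) ≤ k := k.cast_nonneg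
  have hq : (0 : ℚ) ≤ q := q.cast_nonneg
  rw [div_le_iff₀ (by linarith)]
  push_cast
  nlinarith [mul_le_mul_of_nonneg_left hQ' hk]

/-- The value functions are bounded above uniformly in the residual quantity. -/
theorem exists_nuF_le (Q : ℕ) (d p : ℕ → ℕ → ℝ) (s : ℕ → ℕ) (j i : ℕ) :
    ∃ C, ∀ q, nuF Q d p s j i q ≤ C := by
  cases j with
  | zero => exact ⟨_, fun _ => le_rfl⟩
  | succ j => exact ⟨_, fun _ => min_le_right _ _⟩

/-- A lower bound for the future value is preserved by averaging over the demand. -/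
theorem le_tsum_restock {Q : ℕ} (hQ : 1 ≤ Q) {P : ℕ → ℝ} (hP : ∀ k, 0 ≤ P k)
    (hP1 : HasSum P 1) (hPk : Summable fun k : ℕ => (k : ℝ) * P k)
    {D L C : ℝ} (hD : 0 ≤ D) (hL : 0 ≤ L) {f : ℕ → ℝ} (hf : ∀ k, L ≤ f k)
    (hC : ∀ k, f k ≤ C) (q : ℕ) :
    L ≤ ∑' k : ℕ, (D * (psi Q k q : ℝ) + f k) * P k := by
  have h0 (k : ℕ) : (0 : ℝ) ≤ psi Q k q := by exact_mod_cast psi_nonneg Q k q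
  have h1 (k : ℕ) : (psi Q k q : ℝ) ≤ k := by exact_mod_cast psi_le hQ k q
  have hlow (k : ℕ) : L ≤ D * (psi Q k q : ℝ) + f k :=
    (hf k).trans (le_add_of_nonneg_left (mul_nonneg hD (h0 k)))
  have hsum : Summable fun k : ℕ => (D * (psi Q k q : ℝ) + f k) * P k := by
    refine Summable.of_nonneg_of_le (fun k => mul_nonneg (hL.trans (hlow k)) (hP k))
      (fun k => ?_) ((hPk.mul_left D).add (hP1.summable.mul_left C))
    rw [← mul_assoc, ← add_mul]
    exact mul_le_mul_of_nonneg_right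
      (add_le_add (mul_le_mul_of_nonneg_left (h1 k) hD) (hC k)) (hP k)
  have hLs : HasSum (fun k => L * P k) L := by simpa using hP1.mul_left L
  exact hasSum_le (fun k => mul_le_mul_of_nonneg_right (hlow k) (hP k)) hLs hsum.hasSum

theorem chainVal_nonneg {N : ℕ} {d : ℕ → ℕ → ℝ}
    (hd0 : ∀ i j, i ≤ N → j ≤ N → 0 ≤ d i j) {b : ℕ} (hb : b ≤ N) :
    ∀ (t : List ℕ) (a : ℕ), a ≤ N → (∀ u ∈ t, u ≤ N) → 0 ≤ chainVal d a t b
  | [], a, ha, _ => hd0 a b ha hb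
  | w :: t, a, ha, ht =>
    add_nonneg (hd0 a w ha (ht w (by simp)))
      (chainVal_nonneg hd0 hb t w (ht w (by simp)) fun u hu => ht u (by simp [hu]))

theorem chainVal_append_cons (c : ℕ → ℕ → ℝ) (n b : ℕ) (t : List ℕ) :
    ∀ (e : List ℕ) (a : ℕ), chainVal c a (e ++ n :: t) b = chainVal c a e n + chainVal c n t b
  | [], _ => rfl
  | w :: e, a => by
    simp only [List.cons_append, chainVal, chainVal_append_cons c n b t e w, add_assoc]

theorem chainVal_add (c c' : ℕ → ℕ → ℝ) (b : ℕ) :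
    ∀ (t : List ℕ) (a : ℕ),
      chainVal (fun x y => c x y + c' x y) a t b = chainVal c a t b + chainVal c' a t b
  | [], _ => rfl
  | w :: t, a => by
    simp only [chainVal, chainVal_add c c' b t w]
    ring

/-- The value function at a node dominates the length of the remaining a priori path. -/
theorem chainVal_le_nuF {Q N : ℕ} (hQ : 1 ≤ Q) {d : ℕ → ℕ → ℝ}
    (hd0 : ∀ i j, i ≤ N → j ≤ N → 0 ≤ d i j)
    (htri : ∀ i j k, i ≤ N → j ≤ N → k ≤ N → d i j ≤ d i k + d k j)
    {p : ℕ → ℕ → ℝ}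
    (hp : ∀ m, 1 ≤ m → m ≤ N →
      (∀ k, 0 ≤ p m k) ∧ HasSum (p m) 1 ∧ Summable fun k : ℕ => (k : ℝ) * p m k)
    (s : ℕ → ℕ) (t : List ℕ) (ht : ∀ u ∈ t, 1 ≤ u ∧ u ≤ N) (i q : ℕ) (hi : s i ≤ N)
    (hs : ∀ j, s (i + 1 + j) = t.getD j 0) :
    chainVal d (s i) t 0 ≤ nuF Q d p s t.length i q := by
  induction t generalizing i q with
  | nil => exact le_rfl
  | cons w t ih =>
    obtain ⟨hw1, hwN⟩ := ht w (by simp)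
    have hw : s (i + 1) = w := by simpa using hs 0
    have ht' : ∀ u ∈ t, 1 ≤ u ∧ u ≤ N := fun u hu => ht u (by simp [hu])
    have hnext (q' : ℕ) : chainVal d w t 0 ≤ nuF Q d p s t.length (i + 1) q' := by
      have := ih ht' (i + 1) q' (hw ▸ hwN) fun j => by
        simpa [add_assoc, add_comm, add_left_comm] using hs (j + 1)
      rwa [hw] at this
    obtain ⟨C, hC⟩ := exists_nuF_le Q d p s t.length (i + 1)
    obtain ⟨hP, hP1, hPk⟩ := hp w hw1 hwN
    have htsum (q' : ℕ) := le_tsum_restock hQ hP hP1 hPk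
      (add_nonneg (hd0 w 0 hwN N.zero_le) (hd0 0 w N.zero_le hwN))
      (chainVal_nonneg hd0 N.zero_le t w hwN fun u hu => (ht' u hu).2)
      (fun k : ℕ => hnext ((Q : ℤ) * psi Q k q' + (q' : ℤ) - (k : ℤ)).toNat)
      (fun k => hC _) q'
    simp only [List.length_cons, nuF, chainVal, hw]
    exact le_min (add_le_add le_rfl (htsum q))
      (add_le_add (htri _ _ _ hi hwN N.zero_le) (htsum Q))

/-- Proposition 3 of the paper: forward RCSP completion bound:
for a partial route suffix `σ` with first customer `n` and remaining load
`rl ≥ 0`, every ng-feasible completion `e` (total expected demand at most `rl`)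
yields a route whose reduced cost is at least
`ψ(n, rl + μ_n) + ap(σ) + Γ(σ)`, where `ψ(n, rl + μ_n)` is the infimum (in
`EReal`, over all finite sequences `w` of customers with
`Σ μ_{w_j} + μ_n ≤ rl + μ_n`) of the `d + γ` value of the path
`0 → w₁ → … → w_m → n`. -/
theorem stmt10 (Q N : ℕ) (hQ : 1 ≤ Q)
    (d : ℕ → ℕ → ℝ) (hd0 : ∀ i j, i ≤ N → j ≤ N → 0 ≤ d i j)
    (htri : ∀ i j k, i ≤ N → j ≤ N → k ≤ N → d i j ≤ d i k + d k j)
    (p : ℕ → ℕ → ℝ)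
    (hp : ∀ m, 1 ≤ m → m ≤ N →
      (∀ k, 0 ≤ p m k) ∧ HasSum (p m) 1 ∧ Summable fun k : ℕ => (k : ℝ) * p m k)
    (γ : ℕ → ℕ → ℝ)
    (σ : List ℕ) (hσ : σ ≠ []) (hσC : ∀ u ∈ σ, 1 ≤ u ∧ u ≤ N)
    (rl : ℝ) (hrl : 0 ≤ rl) :
    ∀ e : List ℕ, (∀ u ∈ e, 1 ≤ u ∧ u ≤ N) → (e.map (muE p)).sum ≤ rl →
      sInf {x : EReal | ∃ w : List ℕ, (∀ u ∈ w, 1 ≤ u ∧ u ≤ N) ∧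
            (w.map (muE p)).sum + muE p σ.headI ≤ rl + muE p σ.headI ∧
            x = ((chainVal (fun a b => d a b + γ a b) 0 w σ.headI : ℝ) : EReal)}
          + ((chainVal d σ.headI σ.tail 0 : ℝ) : EReal)
          + ((chainVal γ σ.headI σ.tail 0 : ℝ) : EReal) ≤
        ((routePhi Q d p γ (e ++ σ) : ℝ) : EReal) := by
  intro e he hmu
  obtain ⟨n, τ, rfl⟩ := List.exists_cons_of_ne_nil hσ
  have hcost : chainVal d 0 (e ++ n :: τ) 0 ≤ routeCost Q d p (e ++ n :: τ) := by
    refine chainVal_le_nuF hQ hd0 htri hp (routeSeq (e ++ n :: τ)) (e ++ n :: τ) ?_ 0 Q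
      N.zero_le fun j => ?_
    · intro u hu
      exact (List.mem_append.1 hu).elim (he u) (hσC u)
    · simp [routeSeq]
  refine le_trans (add_le_add (add_le_add (sInf_le
    (a := ((chainVal (fun a b => d a b + γ a b) 0 e n : ℝ) : EReal)) ?_) le_rfl) le_rfl) ?_
  · exact ⟨e, he, add_le_add hmu le_rfl, rfl⟩
  simp only [List.headI, List.tail]
  norm_cast
  rw [chainVal_append_cons] at hcost
  rw [routePhi, chainVal_append_cons, chainVal_add]
  linarith
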